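/- Let Q_{k+1} = T_clip Q_k be the clipped Advantage Learning iterates from any Q_0 : S × A → ℝ, V_k = V_{Q_k}, π* an optimal deterministic policy, and Δ_k^{π*}(s) = V_k(s) − Q_k(s, π*(s)). Let 𝟙_k(s) = 1 if Q_k(s,π*(s)) − Q_l ≥ c (V_k(s) − Q_l) and 𝟙_k(s) = 0 otherwise. Then for every k ≥ 0: ‖V* − V_{k+1}‖_∞ ≤ γ ‖V* − V_k‖_∞ + α ‖Δ_k^{π*} · 𝟙_k‖_∞, where (Δ_k^{π*} · 𝟙_k)(s) = Δ_k^{π*}(s) 𝟙_k(s). In particular the error increment α ‖Δ_k^{π*} · 𝟙_k‖_∞ is at most the corresponding AL increment α ‖Δ_k^{π*}‖_∞. -/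

import Mathlib

open Filter Topology Finset

/-- Value function induced by a Q-function: `V_Q(s) = max_a Q(s,a)`. -/
noncomputable def Vof {S A : Type*} [Fintype A] [Nonempty A]
    (Q : S → A → ℝ) (s : S) : ℝ := ⨆ a, Q s a

/-- Bellman optimality operator `(T Q)(s,a) = r(s,a) + γ Σ_{s'} P(s'|s,a) V_Q(s')`. -/
noncomputable def bellmanOp {S A : Type*} [Fintype S] [Fintype A] [Nonempty A]
    (P : S → A → S → ℝ) (r : S → A → ℝ) (γ : ℝ)
    (Q : S → A → ℝ) : S → A → ℝ :=
  fun s a => r s a + γ * ∑ s', P s a s' * Vof Q s'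

/-- Advantage Learning operator `(T_AL Q)(s,a) = (T Q)(s,a) - α (V_Q(s) - Q(s,a))`. -/
noncomputable def alOp {S A : Type*} [Fintype S] [Fintype A] [Nonempty A]
    (P : S → A → S → ℝ) (r : S → A → ℝ) (γ α : ℝ)
    (Q : S → A → ℝ) : S → A → ℝ :=
  fun s a => bellmanOp P r γ Q s a - α * (Vof Q s - Q s a)

/-- Clipped Advantage Learning operator. -/
noncomputable def clipOp {S A : Type*} [Fintype S] [Fintype A] [Nonempty A]
    (P : S → A → S → ℝ) (r : S → A → ℝ) (γ α c Ql : ℝ)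
    (Q : S → A → ℝ) : S → A → ℝ :=
  fun s a => if Q s a - Ql ≥ c * (Vof Q s - Ql)
    then alOp P r γ α Q s a else bellmanOp P r γ Q s a

/-- Sup norm over a finite nonempty domain. -/
noncomputable def supNorm {S : Type*} [Fintype S] [Nonempty S] (f : S → ℝ) : ℝ :=
  ⨆ s, |f s|

theorem aux_le_Vof {S A : Type*} [Fintype A] [Nonempty A]
    (Q : S → A → ℝ) (s : S) (a : A) : Q s a ≤ Vof Q s :=
  le_ciSup (f := fun a => Q s a) (Set.finite_range _).bddAbove a

theorem aux_le_supNorm {S : Type*} [Fintype S] [Nonempty S] (f : S → ℝ) (s : S) :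
    |f s| ≤ supNorm f :=
  le_ciSup (f := fun s => |f s|) (Set.finite_range _).bddAbove s

theorem aux_bellman {S A : Type*} [Fintype S] [Nonempty S] [Fintype A] [Nonempty A]
    (P : S → A → S → ℝ) (hP0 : ∀ s a s', 0 ≤ P s a s')
    (hP1 : ∀ s a, ∑ s', P s a s' = 1)
    (r : S → A → ℝ) (γ : ℝ) (hγ0 : 0 ≤ γ) (Q Q' : S → A → ℝ) (s : S) (a : A) :
    |bellmanOp P r γ Q s a - bellmanOp P r γ Q' s a| ≤
      γ * supNorm (fun s => Vof Q s - Vof Q' s) := by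
  have h : bellmanOp P r γ Q s a - bellmanOp P r γ Q' s a
      = γ * ∑ s', P s a s' * (Vof Q s' - Vof Q' s') := by
    simp only [bellmanOp, mul_sub, Finset.sum_sub_distrib]
    ring
  rw [h, abs_mul, abs_of_nonneg hγ0]
  refine mul_le_mul_of_nonneg_left ?_ hγ0
  calc |∑ s', P s a s' * (Vof Q s' - Vof Q' s')|
      ≤ ∑ s', |P s a s' * (Vof Q s' - Vof Q' s')| := Finset.abs_sum_le_sum_abs _ _
    _ ≤ ∑ s', P s a s' * supNorm (fun s => Vof Q s - Vof Q' s) := by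
        refine Finset.sum_le_sum fun s' _ => ?_
        rw [abs_mul, abs_of_nonneg (hP0 s a s')]
        exact mul_le_mul_of_nonneg_left
          (aux_le_supNorm (fun s => Vof Q s - Vof Q' s) s') (hP0 s a s')
    _ = supNorm (fun s => Vof Q s - Vof Q' s) := by
        rw [← Finset.sum_mul, hP1, one_mul]

theorem stmt_14
    {S A : Type*} [Fintype S] [Nonempty S] [Fintype A] [Nonempty A]
    (P : S → A → S → ℝ) (hP0 : ∀ s a s', 0 ≤ P s a s')
    (hP1 : ∀ s a, ∑ s', P s a s' = 1)
    (r : S → A → ℝ) (γ : ℝ) (hγ0 : 0 ≤ γ) (hγ1 : γ < 1)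
    (Qstar : S → A → ℝ) (hQstar : bellmanOp P r γ Qstar = Qstar)
    (α : ℝ) (hα0 : 0 ≤ α) (hα1 : α < 1)
    (c : ℝ) (hc0 : 0 < c) (hc1 : c < 1) (Ql : ℝ)
    (πstar : S → A) (hπstar : ∀ s, Qstar s (πstar s) = Vof Qstar s)
    (Qseq : ℕ → S → A → ℝ)
    (hQseq : ∀ k, Qseq (k + 1) = clipOp P r γ α c Ql (Qseq k))
 :
    ∀ k : ℕ,
      supNorm (fun s => Vof Qstar s - Vof (Qseq (k + 1)) s) ≤
        γ * supNorm (fun s => Vof Qstar s - Vof (Qseq k) s) +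
          α * supNorm (fun s =>
            (Vof (Qseq k) s - Qseq k s (πstar s)) *
              (if Qseq k s (πstar s) - Ql ≥ c * (Vof (Qseq k) s - Ql)
                then (1 : ℝ) else 0)) ∧
      α * supNorm (fun s =>
            (Vof (Qseq k) s - Qseq k s (πstar s)) *
              (if Qseq k s (πstar s) - Ql ≥ c * (Vof (Qseq k) s - Ql)
                then (1 : ℝ) else 0)) ≤
        α * supNorm (fun s => Vof (Qseq k) s - Qseq k s (πstar s)) := by
  intro k
  constructor
  · refine ciSup_le fun s => ?_
    have hN0 := fun s => aux_le_supNorm (fun s =>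
            (Vof (Qseq k) s - Qseq k s (πstar s)) *
              (if Qseq k s (πstar s) - Ql ≥ c * (Vof (Qseq k) s - Ql)
                then (1 : ℝ) else 0)) s
    have hB := aux_bellman P hP0 hP1 r γ hγ0 Qstar (Qseq k)
    rw [hQstar] at hB
    set M := supNorm (fun s => Vof Qstar s - Vof (Qseq k) s)
    set N := supNorm (fun s =>
            (Vof (Qseq k) s - Qseq k s (πstar s)) *
              (if Qseq k s (πstar s) - Ql ≥ c * (Vof (Qseq k) s - Ql)
                then (1 : ℝ) else 0))
    have hN := mul_le_mul_of_nonneg_left ((le_abs_self _).trans (hN0 s)) hα0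
    have hNn : 0 ≤ α * N := mul_nonneg hα0 ((abs_nonneg _).trans (hN0 s))
    have hup : Vof (Qseq (k + 1)) s ≤ Vof Qstar s + γ * M := by
      refine ciSup_le fun a => ?_
      have h1 := abs_le.1 (hB s a)
      have h2 := aux_le_Vof Qstar s a
      have h3 : 0 ≤ α * (Vof (Qseq k) s - Qseq k s a) :=
        mul_nonneg hα0 (sub_nonneg.2 (aux_le_Vof _ s a))
      rw [hQseq]
      simp only [clipOp, alOp]
      split_ifs <;> linarith [h1.1]
    have hlo : Vof Qstar s ≤ Vof (Qseq (k + 1)) s + γ * M + α * N := by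
      have h1 := abs_le.1 (hB s (πstar s))
      have h2 := aux_le_Vof (Qseq (k + 1)) s (πstar s)
      have h3 := hπstar s
      have h4 : Qseq (k + 1) s (πstar s) = clipOp P r γ α c Ql (Qseq k) s (πstar s) := by
        rw [hQseq]
      simp only [clipOp, alOp] at h4
      split_ifs at h4 hN <;> linarith [h1.2]
    exact abs_le.2 ⟨by linarith, by linarith⟩
  · refine mul_le_mul_of_nonneg_left (ciSup_le fun s => ?_) hα0
    refine le_trans ?_ (aux_le_supNorm (fun s => Vof (Qseq k) s - Qseq k s (πstar s)) s)
    dsimp only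
    split_ifs <;> simp
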